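/- If a tensor-train approximation T of a d-dimensional tensor U satisfies ‖U − T‖_F^2 ≤ Σ_{k=1}^{d-1} ε_k^2, where each ε_k bounds the truncation error of the SVD of the k-th unfolding, and for each k the best rank-r_k approximation error of the k-th unfolding is at most ε_k, then ‖U − T‖_F ≤ √(d−1) · ‖U − U_best‖_F, where U_best is the best tensor-train approximation of U with the given ranks in the Frobenius norm (assuming such a best approximation exists). -/

import Mathlib

open scoped BigOperators

/-- Partial left-to-right product of TT cores: the product
`G₁(i₁) G₂(i₂) ⋯ G_m(i_m)` as a matrix of size `r 0 × r m`. -/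
def ttPartial {d : ℕ} (r : ℕ → ℕ) (n : Fin d → ℕ)
    (G : (k : Fin d) → Fin (n k) → Matrix (Fin (r k)) (Fin (r (k + 1))) ℝ)
    (i : (k : Fin d) → Fin (n k)) :
    (m : ℕ) → m ≤ d → Matrix (Fin (r 0)) (Fin (r m)) ℝ
  | 0, _ => 1
  | m + 1, h =>
      ttPartial r n G i m (Nat.le_of_succ_le h) * G ⟨m, h⟩ (i ⟨m, h⟩)

/-- The entry of the tensor represented by the TT cores `G` at multi-index `i`. -/
def ttEntry {d : ℕ} (r : ℕ → ℕ) (n : Fin d → ℕ)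
    (G : (k : Fin d) → Fin (n k) → Matrix (Fin (r k)) (Fin (r (k + 1))) ℝ)
    (i : (k : Fin d) → Fin (n k)) : ℝ :=
  ∑ a, ∑ b, ttPartial r n G i d le_rfl a b

/-- `G` is a tensor-train representation of the tensor `U` with ranks `r`
(where `r 0 = r d = 1`). -/
def IsTTRepr {d : ℕ} {n : Fin d → ℕ} (U : ((k : Fin d) → Fin (n k)) → ℝ)
    (r : ℕ → ℕ)
    (G : (k : Fin d) → Fin (n k) → Matrix (Fin (r k)) (Fin (r (k + 1))) ℝ) : Prop :=
  r 0 = 1 ∧ r d = 1 ∧ ∀ i, U i = ttEntry r n G i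

/-- The `k`-th unfolding of a `d`-dimensional tensor. -/
def unfold {d : ℕ} (n : Fin d → ℕ) (U : ((j : Fin d) → Fin (n j)) → ℝ) (k : ℕ) :
    Matrix ((j : {j : Fin d // (j : ℕ) < k}) → Fin (n j))
      ((j : {j : Fin d // ¬ (j : ℕ) < k}) → Fin (n j)) ℝ :=
  Matrix.of fun a b => U fun j => if h : (j : ℕ) < k then a ⟨j, h⟩ else b ⟨j, h⟩

/-- Frobenius norm of a tensor. -/
noncomputable def froNorm {d : ℕ} {n : Fin d → ℕ}
    (U : ((j : Fin d) → Fin (n j)) → ℝ) : ℝ :=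
  Real.sqrt (∑ i, (U i) ^ 2)

/-- `U` admits some TT representation whose interior ranks are bounded by `r`. -/
def HasTTRanksLE {d : ℕ} (n : Fin d → ℕ) (U : ((j : Fin d) → Fin (n j)) → ℝ)
    (r : ℕ → ℕ) : Prop :=
  ∃ (r' : ℕ → ℕ) (G : (k : Fin d) → Fin (n k) → Matrix (Fin (r' k)) (Fin (r' (k + 1))) ℝ),
    IsTTRepr U r' G ∧ ∀ k : ℕ, 0 < k → k < d → r' k ≤ r k

/-- `σ_k`: the Frobenius-distance of `U` to tensors whose `k`-th unfolding has
rank at most `r k`. -/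
noncomputable def sigmaK {d : ℕ} (n : Fin d → ℕ) (U : ((j : Fin d) → Fin (n j)) → ℝ)
    (r : ℕ → ℕ) (k : ℕ) : ℝ :=
  sInf {x : ℝ | ∃ V, (unfold n V k).rank ≤ r k ∧ x = froNorm (U - V)}

section Projection

variable {ι : Type*} [Fintype ι] [DecidableEq ι]

/-- Every coordinate subspace has an orthogonal projector, given by a matrix. -/
lemma exists_orthogonal_projector (W : Submodule ℝ (ι → ℝ)) :
    ∃ P : Matrix ι ι ℝ, (∀ v, P.mulVec v ∈ W) ∧
      (∀ x a, ∑ i, (x i - P.mulVec a i) ^ 2 ≤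
        ∑ i, (x i - P.mulVec x i) ^ 2 + ∑ i, (x i - a i) ^ 2) ∧
      ∀ x, ∀ w ∈ W, ∑ i, (x i - P.mulVec x i) ^ 2 ≤ ∑ i, (x i - w i) ^ 2 := by
  let e := WithLp.linearEquiv 2 ℝ (ι → ℝ)
  let K : Submodule ℝ (EuclideanSpace ℝ ι) := W.comap e.toLinearMap
  let p : (ι → ℝ) →ₗ[ℝ] (ι → ℝ) :=
    e.toLinearMap ∘ₗ K.starProjection.toLinearMap ∘ₗ e.symm.toLinearMap
  have hp : ∀ v, (LinearMap.toMatrix' p).mulVec v = p v := fun v => by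
    rw [← Matrix.toLin'_apply, Matrix.toLin'_toMatrix']
  have hsq : ∀ x y : ι → ℝ, ∑ i, (x i - y i) ^ 2 = ‖e.symm x - e.symm y‖ ^ 2 := fun x y => by
    rw [EuclideanSpace.norm_sq_eq]; simp [e]
  have hpe : ∀ v, e.symm (p v) = K.starProjection (e.symm v) := fun v => by simp [p]
  refine ⟨LinearMap.toMatrix' p, fun v => ?_, fun x a => ?_, fun x w hw => ?_⟩
  · rw [hp]
    exact K.starProjection_apply_mem (e.symm v)
  · simp only [hp, hsq, hpe]
    set X := e.symm x
    set A := e.symm a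
    have horth : inner ℝ (X - K.starProjection X) (K.starProjection (X - A)) = 0 :=
      K.starProjection_inner_eq_zero X _ (K.starProjection_apply_mem _)
    have hsplit : X - K.starProjection A =
        (X - K.starProjection X) + K.starProjection (X - A) := by
      rw [map_sub]; abel
    have hle : ‖K.starProjection (X - A)‖ ≤ ‖X - A‖ := K.norm_starProjection_apply_le _
    rw [hsplit, norm_add_sq_real, horth]
    nlinarith [norm_nonneg (K.starProjection (X - A))]
  · simp only [hp, hsq, hpe]
    have hw' : e.symm w ∈ K := by simpa [K] using hw
    rw [K.starProjection_minimal]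
    refine pow_le_pow_left₀ (Real.iInf_nonneg fun _ => norm_nonneg _) ?_ 2
    exact ciInf_le (f := fun y : K => ‖e.symm x - y‖)
      ⟨0, by rintro _ ⟨y, rfl⟩; exact norm_nonneg _⟩ ⟨e.symm w, hw'⟩

end Projection

lemma isClosed_setOf_rank_le {m n : Type*} [Fintype m] [Fintype n] [DecidableEq n] (r : ℕ) :
    IsClosed {M : Matrix m n ℝ | M.rank ≤ r} := by
  let F : Matrix m n ℝ →ₗ[ℝ] ((n → ℝ) →L[ℝ] (m → ℝ)) :=
    LinearMap.toContinuousLinearMap.toLinearMap ∘ₗ (Matrix.toLin').toLinearMap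
  have hF : Continuous F := F.continuous_of_finiteDimensional
  have h := (isOpen_setOfPred_nat_le_rank (𝕜 := ℝ) (E := n → ℝ)
    (F := m → ℝ) (r + 1)).preimage hF
  rw [← isOpen_compl_iff]
  convert h using 1
  ext M
  simp only [Set.mem_compl_iff, Set.mem_ofPred_eq, Set.mem_preimage, not_le]
  have : (F M : (n → ℝ) →ₗ[ℝ] (m → ℝ)).rank = (M.rank : Cardinal) := by
    simp only [LinearMap.rank, Matrix.rank]
    rw [Module.finrank_eq_rank]
    rfl
  rw [this]
  norm_cast

section Index

variable {d : ℕ} {n : Fin d → ℕ}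

/-- The first `k` coordinates of a multi-index. -/
def leftPart (k : ℕ) (i : (j : Fin d) → Fin (n j)) (j : {j : Fin d // (j : ℕ) < k}) :
    Fin (n j) := i j

/-- The coordinates of a multi-index from position `k` on. -/
def rightPart (k : ℕ) (i : (j : Fin d) → Fin (n j)) (j : {j : Fin d // ¬ (j : ℕ) < k}) :
    Fin (n j) := i j

/-- The multi-index with prescribed first `k` coordinates and prescribed remaining ones. -/
def glue (k : ℕ) (a : (j : {j : Fin d // (j : ℕ) < k}) → Fin (n j))
    (b : (j : {j : Fin d // ¬ (j : ℕ) < k}) → Fin (n j)) (j : Fin d) : Fin (n j) :=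
  if h : (j : ℕ) < k then a ⟨j, h⟩ else b ⟨j, h⟩

lemma unfold_apply (U : ((j : Fin d) → Fin (n j)) → ℝ) (k : ℕ)
    (a : (j : {j : Fin d // (j : ℕ) < k}) → Fin (n j))
    (b : (j : {j : Fin d // ¬ (j : ℕ) < k}) → Fin (n j)) :
    unfold n U k a b = U (glue k a b) := rfl

@[simp]
lemma glue_leftPart_rightPart (k : ℕ) (i : (j : Fin d) → Fin (n j)) :
    glue k (leftPart k i) (rightPart k i) = i := by
  funext j
  simp [glue, leftPart, rightPart]

@[simp]
lemma leftPart_glue (k : ℕ) (a : (j : {j : Fin d // (j : ℕ) < k}) → Fin (n j))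
    (b : (j : {j : Fin d // ¬ (j : ℕ) < k}) → Fin (n j)) :
    leftPart k (glue k a b) = a := by
  funext j
  simp [glue, leftPart, j.2]

@[simp]
lemma rightPart_glue (k : ℕ) (a : (j : {j : Fin d // (j : ℕ) < k}) → Fin (n j))
    (b : (j : {j : Fin d // ¬ (j : ℕ) < k}) → Fin (n j)) :
    rightPart k (glue k a b) = b := by
  funext j
  simp [glue, rightPart, j.2]

lemma froNorm_nonneg (U : ((j : Fin d) → Fin (n j)) → ℝ) : 0 ≤ froNorm U :=
  Real.sqrt_nonneg _

lemma froNorm_sub_sq (U V : ((j : Fin d) → Fin (n j)) → ℝ) (k : ℕ) :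
    froNorm (U - V) ^ 2 = ∑ b, ∑ a, (unfold n U k a b - unfold n V k a b) ^ 2 := by
  rw [froNorm, Real.sq_sqrt (by positivity), Finset.sum_comm, ← Fintype.sum_prod_type',
    ← (Equiv.piEquivPiSubtypeProd (fun j : Fin d => (j : ℕ) < k) (fun j => Fin (n j))).sum_comp]
  refine Finset.sum_congr rfl fun i _ => ?_
  have h := glue_leftPart_rightPart k i
  change _ = (U (glue k (leftPart k i) (rightPart k i)) -
    V (glue k (leftPart k i) (rightPart k i))) ^ 2
  rw [h, Pi.sub_apply]

lemma exists_froNorm_eq_sigmaK (U : ((j : Fin d) → Fin (n j)) → ℝ) (r : ℕ → ℕ) (k : ℕ) :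
    ∃ V, (unfold n V k).rank ≤ r k ∧ froNorm (U - V) = sigmaK n U r k := by
  let e := WithLp.linearEquiv 2 ℝ (((j : Fin d) → Fin (n j)) → ℝ)
  let S : Set (EuclideanSpace ℝ ((j : Fin d) → Fin (n j))) :=
    {V | (unfold n (e V) k).rank ≤ r k}
  have hcont : Continuous fun V : EuclideanSpace ℝ ((j : Fin d) → Fin (n j)) =>
      unfold n (e V) k := by
    refine continuous_matrix fun a b => ?_
    exact (continuous_apply (glue k a b)).comp (PiLp.continuous_ofLp 2 _)
  have hclosed : IsClosed S := (isClosed_setOf_rank_le (r k)).preimage hcont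
  have hzero : unfold n (0 : ((j : Fin d) → Fin (n j)) → ℝ) k = 0 := rfl
  have hne : S.Nonempty := ⟨0, by simp [S, hzero]⟩
  have hnorm : ∀ X Y, froNorm (X - Y) = ‖e.symm X - e.symm Y‖ := fun X Y => by
    rw [EuclideanSpace.norm_eq]; simp [e, froNorm]
  obtain ⟨V, hV, hdist⟩ := hclosed.exists_infDist_eq_dist hne (e.symm U)
  refine ⟨e V, hV, ?_⟩
  have hleast : IsLeast {x : ℝ | ∃ V', (unfold n V' k).rank ≤ r k ∧ x = froNorm (U - V')}
      (froNorm (U - e V)) := by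
    refine ⟨⟨e V, hV, rfl⟩, ?_⟩
    rintro _ ⟨V', hV', rfl⟩
    have := Metric.infDist_le_dist_of_mem (x := e.symm U)
      (show e.symm V' ∈ S by simpa [S] using hV')
    rw [hdist, dist_eq_norm, dist_eq_norm] at this
    simpa [hnorm] using this
  exact hleast.csInf_eq.symm

lemma sigmaK_le_froNorm_sub {U V : ((j : Fin d) → Fin (n j)) → ℝ} {r : ℕ → ℕ} {k : ℕ}
    (hV : (unfold n V k).rank ≤ r k) : sigmaK n U r k ≤ froNorm (U - V) :=
  csInf_le ⟨0, by rintro _ ⟨V, -, rfl⟩; exact froNorm_nonneg _⟩ ⟨V, hV, rfl⟩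

lemma sigmaK_nonneg (U : ((j : Fin d) → Fin (n j)) → ℝ) (r : ℕ → ℕ) (k : ℕ) :
    0 ≤ sigmaK n U r k :=
  Real.sInf_nonneg (by rintro _ ⟨V, -, rfl⟩; exact froNorm_nonneg _)

/-- The tensor whose `k`-th unfolding is `P` times the `k`-th unfolding of `A`. -/
def applyLeft (k : ℕ)
    (P : Matrix ((j : {j : Fin d // (j : ℕ) < k}) → Fin (n j))
      ((j : {j : Fin d // (j : ℕ) < k}) → Fin (n j)) ℝ)
    (A : ((j : Fin d) → Fin (n j)) → ℝ) (i : (j : Fin d) → Fin (n j)) : ℝ :=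
  (P * unfold n A k) (leftPart k i) (rightPart k i)

lemma unfold_applyLeft (k : ℕ)
    (P : Matrix ((j : {j : Fin d // (j : ℕ) < k}) → Fin (n j))
      ((j : {j : Fin d // (j : ℕ) < k}) → Fin (n j)) ℝ)
    (A : ((j : Fin d) → Fin (n j)) → ℝ) :
    unfold n (applyLeft k P A) k = P * unfold n A k := by
  ext a b
  simp [unfold_apply, applyLeft]

lemma rank_unfold_applyLeft_le {j k : ℕ} (hjk : j ≤ k)
    (P : Matrix ((l : {l : Fin d // (l : ℕ) < j}) → Fin (n l))
      ((l : {l : Fin d // (l : ℕ) < j}) → Fin (n l)) ℝ)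
    (A : ((l : Fin d) → Fin (n l)) → ℝ) :
    (unfold n (applyLeft j P A) k).rank ≤ (unfold n A k).rank := by
  let ov (a' : (l : {l : Fin d // (l : ℕ) < j}) → Fin (n l))
      (a : (l : {l : Fin d // (l : ℕ) < k}) → Fin (n l)) :
      (l : {l : Fin d // (l : ℕ) < k}) → Fin (n l) :=
    fun l => if h : (l.1 : ℕ) < j then a' ⟨l.1, h⟩ else a l
  let res (a : (l : {l : Fin d // (l : ℕ) < k}) → Fin (n l)) :
      (l : {l : Fin d // (l : ℕ) < j}) → Fin (n l) :=
    fun l => a ⟨l.1, l.2.trans_le hjk⟩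
  let M : Matrix ((l : {l : Fin d // (l : ℕ) < k}) → Fin (n l))
      ((l : {l : Fin d // (l : ℕ) < k}) → Fin (n l)) ℝ :=
    Matrix.of fun a c => ∑ a', P (res a) a' * if c = ov a' a then 1 else 0
  have hM : unfold n (applyLeft j P A) k = M * unfold n A k := by
    ext a b
    have hres : leftPart j (glue k a b) = res a := by
      funext l
      simp [leftPart, glue, res, l.2.trans_le hjk]
    have hover : ∀ a', glue j a' (rightPart j (glue k a b)) = glue k (ov a' a) b := by
      intro a'
      funext l
      by_cases h : (l : ℕ) < j
      · simp [glue, ov, h, h.trans_le hjk]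
      · simp [glue, ov, rightPart, h]
    simp only [unfold_apply, applyLeft, Matrix.mul_apply, hres, hover, M, Matrix.of_apply, Finset.sum_mul]
    rw [Finset.sum_comm]
    refine Finset.sum_congr rfl fun a' _ => ?_
    simp
  rw [hM]
  exact Matrix.rank_mul_le_right _ _

/-- One truncation step of TT-SVD. -/
lemma exists_truncation (U A : ((j : Fin d) → Fin (n j)) → ℝ) (r : ℕ → ℕ) (k : ℕ) :
    ∃ T, (unfold n T k).rank ≤ r k ∧
      (∀ l, k ≤ l → (unfold n T l).rank ≤ (unfold n A l).rank) ∧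
      froNorm (U - T) ^ 2 ≤ sigmaK n U r k ^ 2 + froNorm (U - A) ^ 2 := by
  obtain ⟨V, hVr, hV⟩ := exists_froNorm_eq_sigmaK U r k
  obtain ⟨P, hPmem, hPerr, hPmin⟩ :=
    exists_orthogonal_projector (Submodule.span ℝ (Set.range (unfold n V k).col))
  have hcol : ∀ (X : ((j : Fin d) → Fin (n j)) → ℝ) a b,
      (P * unfold n X k) a b = P.mulVec (fun c => unfold n X k c b) a := fun X a b => rfl
  refine ⟨applyLeft k P A, ?_, fun l hl => rank_unfold_applyLeft_le hl P A, ?_⟩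
  · rw [Matrix.rank_eq_finrank_span_cols] at hVr ⊢
    refine (Submodule.finrank_mono ?_).trans hVr
    rw [Submodule.span_le]
    rintro _ ⟨b, rfl⟩
    rw [unfold_applyLeft]
    exact hPmem (fun c => unfold n A k c b)
  · rw [← hV]
    simp only [froNorm_sub_sq _ _ k]
    rw [← Finset.sum_add_distrib]
    refine Finset.sum_le_sum fun b _ => ?_
    simp only [unfold_applyLeft, hcol]
    refine (hPerr (fun c => unfold n U k c b) (fun c => unfold n A k c b)).trans ?_
    refine add_le_add_left ?_ _
    exact hPmin _ (fun a => unfold n V k a b) (Submodule.subset_span ⟨b, rfl⟩)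

lemma exists_low_rank_unfoldings (U : ((j : Fin d) → Fin (n j)) → ℝ) (r : ℕ → ℕ)
    {k : ℕ} (hk : k ≤ d) :
    ∃ T, (∀ l, k ≤ l → l < d → (unfold n T l).rank ≤ r l) ∧
      froNorm (U - T) ^ 2 ≤ ∑ l ∈ Finset.Ico k d, sigmaK n U r l ^ 2 := by
  induction hk using Nat.decreasingInduction with
  | self => exact ⟨U, fun l h h' => by omega, by simp [froNorm]⟩
  | of_succ k hk ih =>
    obtain ⟨A, hA, hAerr⟩ := ih
    obtain ⟨T, hT, hTA, hTerr⟩ := exists_truncation U A r k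
    refine ⟨T, fun l hkl hl => ?_, ?_⟩
    · rcases hkl.eq_or_lt with rfl | h
      · exact hT
      · exact (hTA l hkl).trans (hA l h hl)
    · rw [Finset.sum_eq_sum_Ico_succ_bot hk]
      linarith

end Index

section TensorTrain

variable {d : ℕ} {n : Fin d → ℕ}

lemma exists_ttPartial_eq_left (r : ℕ → ℕ)
    (G : (k : Fin d) → Fin (n k) → Matrix (Fin (r k)) (Fin (r (k + 1))) ℝ)
    (k : ℕ) (hk : k ≤ d) :
    ∃ L : ((j : {j : Fin d // (j : ℕ) < k}) → Fin (n j)) →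
      Matrix (Fin (r 0)) (Fin (r k)) ℝ, ∀ i, ttPartial r n G i k hk = L (leftPart k i) := by
  induction k with
  | zero => exact ⟨fun _ => 1, fun i => rfl⟩
  | succ m ih =>
    obtain ⟨L, hL⟩ := ih (Nat.le_of_succ_le hk)
    refine ⟨fun a => L (fun j => a ⟨j.1, j.2.trans m.lt_succ_self⟩) *
      G ⟨m, hk⟩ (a ⟨⟨m, hk⟩, m.lt_succ_self⟩), fun i => ?_⟩
    rw [ttPartial, hL]
    rfl

lemma exists_ttPartial_eq_mul (r : ℕ → ℕ)
    (G : (k : Fin d) → Fin (n k) → Matrix (Fin (r k)) (Fin (r (k + 1))) ℝ)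
    {k m : ℕ} (hkm : k ≤ m) (hm : m ≤ d) :
    ∃ R : ((j : {j : Fin d // ¬ (j : ℕ) < k}) → Fin (n j)) →
      Matrix (Fin (r k)) (Fin (r m)) ℝ,
      ∀ i, ttPartial r n G i m hm =
        ttPartial r n G i k (hkm.trans hm) * R (rightPart k i) := by
  induction m, hkm using Nat.le_induction with
  | base => exact ⟨fun _ => 1, fun i => (Matrix.mul_one _).symm⟩
  | succ m hkm ih =>
    obtain ⟨R, hR⟩ := ih (Nat.le_of_succ_le hm)
    refine ⟨fun b => R b * G ⟨m, hm⟩ (b ⟨⟨m, hm⟩, hkm.not_gt⟩), fun i => ?_⟩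
    rw [ttPartial, hR, Matrix.mul_assoc]
    rfl

lemma HasTTRanksLE.rank_unfold_le {V : ((j : Fin d) → Fin (n j)) → ℝ} {r : ℕ → ℕ}
    (hV : HasTTRanksLE n V r) {k : ℕ} (hk : 0 < k) (hkd : k < d) :
    (unfold n V k).rank ≤ r k := by
  obtain ⟨r', G, ⟨-, -, hG⟩, hr⟩ := hV
  obtain ⟨L, hL⟩ := exists_ttPartial_eq_left r' G k hkd.le
  obtain ⟨R, hR⟩ := exists_ttPartial_eq_mul r' G hkd.le le_rfl
  have hfac : unfold n V k =
      (Matrix.of fun a c => ∑ p, L a p c) * (Matrix.of fun c b => ∑ q, R b c q) := by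
    ext a b
    rw [unfold_apply, hG, ttEntry, hR, hL, leftPart_glue, rightPart_glue]
    simp only [Matrix.mul_apply, Matrix.of_apply, Finset.sum_mul, Finset.mul_sum]
    rw [Finset.sum_comm]
    simp_rw [Finset.sum_comm (s := (Finset.univ : Finset (Fin (r' 0))))
      (t := (Finset.univ : Finset (Fin (r' k))))]
    rw [Finset.sum_comm]
  rw [hfac]
  refine (Matrix.rank_mul_le_left _ _).trans
    ((Matrix.rank_le_card_width _).trans (by simpa using hr k hk hkd))

/-- The column space of the `k`-th unfolding. -/
noncomputable def colSpace (T : ((j : Fin d) → Fin (n j)) → ℝ) (k : ℕ) :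
    Submodule ℝ (((j : {j : Fin d // (j : ℕ) < k}) → Fin (n j)) → ℝ) :=
  Submodule.span ℝ (Set.range (unfold n T k).col)

/-- Fixing the last left index maps the column space of one unfolding into that of the previous
one. -/
lemma exists_mem_colSpace_slice (T : ((j : Fin d) → Fin (n j)) → ℝ) (k : Fin d) (x : Fin (n k))
    {f : ((j : {j : Fin d // (j : ℕ) < (k : ℕ) + 1}) → Fin (n j)) → ℝ}
    (hf : f ∈ colSpace T (k + 1)) :
    ∃ g ∈ colSpace T k, ∀ i, i k = x → f (leftPart (k + 1) i) = g (leftPart k i) := by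
  induction hf using Submodule.span_induction with
  | mem f hf =>
    obtain ⟨b, rfl⟩ := hf
    by_cases hx : ∃ i₀ : (j : Fin d) → Fin (n j), i₀ k = x
    · obtain ⟨i₀, rfl⟩ := hx
      refine ⟨(unfold n T k).col (rightPart k (glue (k + 1) (leftPart (k + 1) i₀) b)),
        Submodule.subset_span ⟨_, rfl⟩, fun i hi => ?_⟩
      simp only [Matrix.col_apply, unfold_apply]
      congr 1
      funext l
      rcases lt_trichotomy l k with h | rfl | h
      · have h' : (l : ℕ) < k := h
        simp [glue, leftPart, h', h'.trans (Nat.lt_succ_self _)]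
      · simp [glue, leftPart, rightPart, hi]
      · have h' : (k : ℕ) < l := h
        simp [glue, rightPart, h'.not_gt, show ¬ (l : ℕ) < k + 1 by omega]
    · exact ⟨0, zero_mem _, fun i hi => (hx ⟨i, hi⟩).elim⟩
  | zero => exact ⟨0, zero_mem _, fun _ _ => rfl⟩
  | add f₁ f₂ _ _ h₁ h₂ =>
    obtain ⟨g₁, hg₁, h₁⟩ := h₁
    obtain ⟨g₂, hg₂, h₂⟩ := h₂
    exact ⟨g₁ + g₂, add_mem hg₁ hg₂, fun i hi => by simp [h₁ i hi, h₂ i hi]⟩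
  | smul c f _ h =>
    obtain ⟨g, hg, h⟩ := h
    exact ⟨c • g, Submodule.smul_mem _ c hg, fun i hi => by simp [h i hi]⟩

lemma exists_spanning_family (hd : 1 ≤ d) (T : ((j : Fin d) → Fin (n j)) → ℝ) (k : ℕ) :
    ∃ (ρ : ℕ) (φ : Fin ρ → ((j : {j : Fin d // (j : ℕ) < k}) → Fin (n j)) → ℝ),
      (k = 0 → ρ = 1 ∧ ∀ c a, φ c a = 1) ∧
      (k = d → ρ = 1 ∧ ∀ c i, φ c (leftPart k i) = T i) ∧
      (0 < k → k < d → ρ = (unfold n T k).rank) ∧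
      (k < d → colSpace T k ≤ Submodule.span ℝ (Set.range φ)) ∧
      (0 < k → ∀ c, φ c ∈ colSpace T k) := by
  rcases Nat.eq_zero_or_pos k with rfl | hk
  · refine ⟨1, fun _ _ => 1, fun _ => ⟨rfl, fun _ _ => rfl⟩, by omega, by omega,
      fun _ f _ => ?_, by omega⟩
    rw [Set.range_const, Submodule.mem_span_singleton]
    refine ⟨f fun j => absurd j.2 (Nat.not_lt_zero _), ?_⟩
    funext a
    simp only [Pi.smul_apply, smul_eq_mul, mul_one]
    congr 1
    funext j
    exact absurd j.2 (Nat.not_lt_zero _)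
  by_cases hkd : k = d
  · subst hkd
    let b : (j : {j : Fin k // ¬ (j : ℕ) < k}) → Fin (n j) := fun j => absurd j.1.2 j.2
    refine ⟨1, fun _ => (unfold n T k).col b, by omega, fun _ => ⟨rfl, fun _ i => ?_⟩, by omega,
      by omega, fun _ _ => Submodule.subset_span ⟨b, rfl⟩⟩
    change T _ = T i
    congr 1
    funext j
    simp [leftPart]
  · let B := Module.finBasis ℝ (colSpace T k)
    refine ⟨_, fun c => (B c : _ → ℝ), by omega, fun h => absurd h hkd, fun _ _ => ?_, fun _ => ?_,
      fun _ c => (B c).2⟩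
    · rw [Matrix.rank_eq_finrank_span_cols]; rfl
    · have h := congrArg (Submodule.map (colSpace T k).subtype) B.span_eq
      rw [Submodule.map_span, Submodule.map_top, Submodule.range_subtype, ← Set.range_comp] at h
      exact h.ge

/-- A tensor whose unfoldings have ranks at most `r` has a tensor-train representation with ranks
at most `r`. -/
lemma hasTTRanksLE_of_rank_unfold_le (hd : 1 ≤ d) {T : ((j : Fin d) → Fin (n j)) → ℝ}
    {r : ℕ → ℕ} (h : ∀ k, 0 < k → k < d → (unfold n T k).rank ≤ r k) :
    HasTTRanksLE n T r := by
  choose ρ φ h0 hdd hρ hspan hmem using exists_spanning_family hd T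
  have hG : ∀ (k : Fin d) (x : Fin (n k)) (c : Fin (ρ (k + 1))), ∃ w : Fin (ρ k) → ℝ,
      ∀ i, i k = x → φ (k + 1) c (leftPart (k + 1) i) = ∑ b, φ k b (leftPart k i) * w b := by
    intro k x c
    obtain ⟨g, hg, hgi⟩ := exists_mem_colSpace_slice T k x (hmem (k + 1) k.1.succ_pos c)
    obtain ⟨w, rfl⟩ := (Submodule.mem_span_range_iff_exists_fun ℝ).1 (hspan k k.2 hg)
    exact ⟨w, fun i hi => by simp [hgi i hi, mul_comm]⟩
  choose G hG using hG
  have hpart : ∀ i m (hm : m ≤ d) a c,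
      ttPartial ρ n (fun k x => Matrix.of fun b c => G k x c b) i m hm a c =
        φ m c (leftPart m i) := by
    intro i m
    induction m with
    | zero =>
      intro hm a c
      have : Subsingleton (Fin (ρ 0)) := by rw [(h0 0 rfl).1]; infer_instance
      rw [ttPartial, (h0 0 rfl).2, Subsingleton.elim a c, Matrix.one_apply_eq]
    | succ m ih =>
      intro hm a c
      rw [ttPartial, Matrix.mul_apply, hG ⟨m, hm⟩ (i ⟨m, hm⟩) c i rfl]
      exact Finset.sum_congr rfl fun b _ => by rw [ih]; rfl
  refine ⟨ρ, fun k x => Matrix.of fun b c => G k x c b, ⟨(h0 0 rfl).1, (hdd d rfl).1, fun i => ?_⟩,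
    fun k hk hkd => (hρ k hk hkd).trans_le (h k hk hkd)⟩
  simp [ttEntry, hpart, (hdd d rfl).2, (h0 0 rfl).1, (hdd d rfl).1]

end TensorTrain

/-- Quasi-optimality of TT-SVD: any best TT approximation `Ubest` with ranks ≤ `r`
satisfies `‖U − Ubest‖_F ≥ σ_k` for each `k`, and there exists `T` with
`‖U − T‖_F² ≤ Σ_k σ_k²`, hence `‖U − T‖_F ≤ √(d−1)·‖U − Ubest‖_F`. -/
theorem ttsvd_quasi_optimality {d : ℕ} (hd : 1 ≤ d) (n : Fin d → ℕ) (r : ℕ → ℕ)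
    (U Ubest : ((j : Fin d) → Fin (n j)) → ℝ)
    (hbest : HasTTRanksLE n Ubest r)
    (hmin : ∀ V, HasTTRanksLE n V r → froNorm (U - Ubest) ≤ froNorm (U - V)) :
    (∀ k : ℕ, 0 < k → k < d → sigmaK n U r k ≤ froNorm (U - Ubest)) ∧
    ∃ T, HasTTRanksLE n T r ∧
      (froNorm (U - T)) ^ 2 ≤ ∑ k ∈ Finset.Ioo 0 d, (sigmaK n U r k) ^ 2 ∧
      froNorm (U - T) ≤ Real.sqrt ((d : ℝ) - 1) * froNorm (U - Ubest) := by
  have hsig : ∀ k : ℕ, 0 < k → k < d → sigmaK n U r k ≤ froNorm (U - Ubest) :=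
    fun k hk hkd => sigmaK_le_froNorm_sub (hbest.rank_unfold_le hk hkd)
  obtain ⟨T, hT, herr⟩ := exists_low_rank_unfoldings U r hd
  have hIoo : Finset.Ioo 0 d = Finset.Ico 1 d := rfl
  refine ⟨hsig, T, hasTTRanksLE_of_rank_unfold_le hd hT, hIoo ▸ herr, ?_⟩
  have hd' : (0 : ℝ) ≤ (d : ℝ) - 1 := sub_nonneg.2 (by exact_mod_cast hd)
  refine le_of_sq_le_sq ?_ (mul_nonneg (Real.sqrt_nonneg _) (froNorm_nonneg _))
  rw [mul_pow, Real.sq_sqrt hd']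
  calc froNorm (U - T) ^ 2 ≤ ∑ k ∈ Finset.Ico 1 d, sigmaK n U r k ^ 2 := herr
    _ ≤ ∑ _k ∈ Finset.Ico 1 d, froNorm (U - Ubest) ^ 2 := by
        refine Finset.sum_le_sum fun k hk => ?_
        rw [Finset.mem_Ico] at hk
        exact pow_le_pow_left₀ (sigmaK_nonneg U r k) (hsig k hk.1 hk.2) 2
    _ = ((d : ℝ) - 1) * froNorm (U - Ubest) ^ 2 := by
        rw [Finset.sum_const, Nat.card_Ico, nsmul_eq_mul, Nat.cast_sub hd, Nat.cast_one]
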